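/- Let (ω,u) be a smooth solution of the vorticity form of the 2D incompressible Euler equations on ℍ whose initial vorticity ω₀ = ω(0,·) belongs to L¹(ℍ) ∩ L^∞(ℍ) (no sign condition is required). Let X : [0,∞) → ℍ be a differentiable trajectory with X′(t) = u(t,X(t)) and X₂(0) > 0. Then there exists a constant D > 0, depending only on ‖ω₀‖_{L¹} and ‖ω₀‖_{L^∞}, such that X₂(t) ≥ exp(−√(1 + log²(X₂(0))) · e^{Dt}) for all t ≥ 0. -/

import Mathlib

open MeasureTheory

/-- The Euclidean norm on `ℝ × ℝ`. -/
noncomputable def nrm (z : ℝ × ℝ) : ℝ := Real.sqrt (z.1 ^ 2 + z.2 ^ 2)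

/-- The upper half-plane `ℍ = {x ∈ ℝ² : x₂ > 0}`. -/
def Hplane : Set (ℝ × ℝ) := {x | 0 < x.2}

/-- Reflection `x̄ = (x₁, -x₂)`. -/
def pbar (z : ℝ × ℝ) : ℝ × ℝ := (z.1, -z.2)

/-- Perpendicular vector `z^⊥ = (-z₂, z₁)`. -/
def perp (z : ℝ × ℝ) : ℝ × ℝ := (-z.2, z.1)

/-- The half-plane Biot–Savart kernel
`K(x,y) = (x-y)^⊥/(2π|x-y|²) - (x-ȳ)^⊥/(2π|x-ȳ|²)`. -/
noncomputable def Kker (x y : ℝ × ℝ) : ℝ × ℝ :=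
  (2 * Real.pi * nrm (x - y) ^ 2)⁻¹ • perp (x - y) -
    (2 * Real.pi * nrm (x - pbar y) ^ 2)⁻¹ • perp (x - pbar y)

/-- A smooth solution of the vorticity form of the 2D incompressible Euler
equations on the half-plane `ℍ`: `ω` is smooth, compactly supported in `ℍ`
at each time, transported by the velocity `u` recovered from `ω` by the
half-plane Biot–Savart law. -/
structure IsEulerSol (ω : ℝ → ℝ × ℝ → ℝ) (u : ℝ → ℝ × ℝ → ℝ × ℝ) : Prop where
  smooth : ContDiff ℝ (⊤ : ℕ∞) (fun q : ℝ × (ℝ × ℝ) => ω q.1 q.2)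
  compactSupp : ∀ t, HasCompactSupport (ω t)
  suppIn : ∀ t, tsupport (ω t) ⊆ Hplane
  biotSavart : ∀ t x, u t x = ∫ y in Hplane, ω t y • Kker x y
  transport : ∀ t, 0 ≤ t → ∀ x ∈ Hplane,
    deriv (fun s => ω s x) t + fderiv ℝ (ω t) x (u t x) = 0

section HelperLemmas

open Set Filter Topology

/-- The radial profile `r ↦ 1 / (r max(r, ρ))` on `[0, 1)`, extended by zero. -/
noncomputable def profile (ρ : ℝ) : ℝ → ℝ :=
  (Set.Iio (1 : ℝ)).indicator fun s => s⁻¹ * (max s ρ)⁻¹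

lemma profile_nonneg {ρ r : ℝ} (hr : 0 ≤ r) : 0 ≤ profile ρ r := by
  unfold profile
  refine Set.indicator_apply_nonneg fun _ => ?_
  have : 0 ≤ max r ρ := hr.trans (le_max_left _ _)
  positivity

lemma mul_profile_eq {ρ y : ℝ} (hy : 0 < y) :
    y ^ (Module.finrank ℝ (ℝ × ℝ) - 1) • profile ρ y
      = (Set.Iio (1 : ℝ)).indicator (fun s => (max s ρ)⁻¹) y := by
  have : Module.finrank ℝ (ℝ × ℝ) - 1 = 1 := by simp
  rw [this, pow_one, smul_eq_mul, profile]
  by_cases h : y < 1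
  · simp [h, hy.ne']
  · simp [h]

lemma continuous_inv_max {ρ : ℝ} (hρ : 0 < ρ) : Continuous fun r : ℝ => (max r ρ)⁻¹ :=
  (continuous_id.max continuous_const).inv₀ fun _ => (hρ.trans_le (le_max_right _ _)).ne'

lemma integrable_profile_norm {ρ : ℝ} (hρ : 0 < ρ) :
    Integrable (fun z : ℝ × ℝ => profile ρ ‖z‖) := by
  rw [integrable_fun_norm_addHaar (f := profile ρ) volume,
    integrableOn_congr_fun (fun y (hy : y ∈ Ioi (0 : ℝ)) => mul_profile_eq (ρ := ρ) hy) measurableSet_Ioi,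
    IntegrableOn, integrable_indicator_iff measurableSet_Iio, IntegrableOn,
    Measure.restrict_restrict measurableSet_Iio]
  refine ((continuous_inv_max hρ).continuousOn.integrableOn_compact
    (isCompact_Icc (a := (0 : ℝ)) (b := 1))).mono_set ?_
  rintro x ⟨h1, h2⟩
  exact ⟨le_of_lt h2, le_of_lt h1⟩

lemma integral_inv_max_le {ρ : ℝ} (hρ : 0 < ρ) :
    ∫ y in (0 : ℝ)..1, (max y ρ)⁻¹ ≤ 1 + |Real.log ρ| := by
  have hint : ∀ a b : ℝ, IntervalIntegrable (fun y : ℝ => (max y ρ)⁻¹) volume a b := fun a b =>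
    (continuous_inv_max hρ).intervalIntegrable a b
  rcases le_or_gt 1 ρ with h | h
  · have : ∫ y in (0 : ℝ)..1, (max y ρ)⁻¹ ≤ ∫ y in (0 : ℝ)..1, (1 : ℝ) := by
      refine intervalIntegral.integral_mono_on zero_le_one (hint _ _) (by simp) fun x _ => ?_
      exact inv_le_one_of_one_le₀ (h.trans (le_max_right _ _))
    have h2 := abs_nonneg (Real.log ρ)
    simp at this
    linarith
  · rw [← intervalIntegral.integral_add_adjacent_intervals (hint 0 ρ) (hint ρ 1)]
    have h1 : ∫ y in (0 : ℝ)..ρ, (max y ρ)⁻¹ = ∫ y in (0 : ℝ)..ρ, ρ⁻¹ := by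
      refine intervalIntegral.integral_congr fun x hx => ?_
      rw [uIcc_of_le hρ.le] at hx
      simp [max_eq_right hx.2]
    have h2 : ∫ y in ρ..1, (max y ρ)⁻¹ = ∫ y in ρ..1, y⁻¹ := by
      refine intervalIntegral.integral_congr fun x hx => ?_
      rw [uIcc_of_le h.le] at hx
      simp [max_eq_left hx.1]
    rw [h1, h2, integral_inv_of_pos hρ one_pos, one_div, Real.log_inv]
    have := neg_le_abs (Real.log ρ)
    simp [hρ.ne']
    linarith

lemma integral_profile_norm_le {ρ : ℝ} (hρ : 0 < ρ) :
    ∫ z : ℝ × ℝ, profile ρ ‖z‖ ≤ 8 * (1 + |Real.log ρ|) := by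
  rw [integral_fun_norm_addHaar volume (profile ρ),
    setIntegral_congr_fun measurableSet_Ioi (fun y hy => mul_profile_eq hy),
    setIntegral_indicator measurableSet_Iio]
  have hb : (volume : Measure (ℝ × ℝ)).real (Metric.ball 0 1) = 4 := by
    have : Metric.ball (0 : ℝ × ℝ) 1 = Metric.ball (0 : ℝ) 1 ×ˢ Metric.ball (0 : ℝ) 1 := by
      rw [ball_prod_same]; rfl
    rw [this, Measure.volume_eq_prod, measureReal_prod_prod, Real.ball_eq_Ioo]
    norm_num [Measure.real]
  have hI : ∫ y in Ioi (0 : ℝ) ∩ Iio 1, (max y ρ)⁻¹ = ∫ y in (0 : ℝ)..1, (max y ρ)⁻¹ := by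
    rw [intervalIntegral.integral_of_le zero_le_one, integral_Ioc_eq_integral_Ioo]
    rfl
  rw [hb, hI]
  have := integral_inv_max_le hρ
  simp
  linarith

lemma inv_mul_inv_max_le {ρ r : ℝ} (hr : 0 ≤ r) : r⁻¹ * (max r ρ)⁻¹ ≤ 1 + profile ρ r := by
  unfold profile
  by_cases h : r < 1
  · simp [h]
  · push Not at h
    have h1 : r⁻¹ ≤ 1 := inv_le_one_of_one_le₀ h
    have h2 : (max r ρ)⁻¹ ≤ 1 := inv_le_one_of_one_le₀ (h.trans (le_max_left _ _))
    have h3 : 0 ≤ (max r ρ)⁻¹ := inv_nonneg.2 (hr.trans (le_max_left _ _))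
    simp [not_lt.2 h]
    nlinarith

lemma inv_le_one_add_profile {r : ℝ} (hr : 0 ≤ r) : r⁻¹ ≤ 1 + profile 1 r := by
  by_cases h : r < 1
  · have := inv_mul_inv_max_le (ρ := 1) hr
    rwa [max_eq_right h.le, inv_one, mul_one] at this
  · have : profile 1 r = 0 := by simp [profile, h]
    rw [this, add_zero]
    exact inv_le_one_of_one_le₀ (not_lt.1 h)

lemma nrm_sq (z : ℝ × ℝ) : nrm z ^ 2 = z.1 ^ 2 + z.2 ^ 2 := Real.sq_sqrt (by positivity)

lemma norm_le_nrm (z : ℝ × ℝ) : ‖z‖ ≤ nrm z := by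
  rw [Prod.norm_def]
  refine max_le ?_ ?_ <;> refine Real.le_sqrt_of_sq_le ?_ <;>
    rw [Real.norm_eq_abs, sq_abs] <;> nlinarith [sq_nonneg z.1, sq_nonneg z.2]

lemma nrm_nonneg (z : ℝ × ℝ) : 0 ≤ nrm z := Real.sqrt_nonneg _

lemma norm_perp (z : ℝ × ℝ) : ‖perp z‖ = ‖z‖ := by
  simp [perp, Prod.norm_def, max_comm]

lemma nrm_sub_le_nrm_sub_pbar {x y : ℝ × ℝ} (hx : x ∈ Hplane) (hy : y ∈ Hplane) :
    nrm (x - y) ≤ nrm (x - pbar y) := by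
  have hx' : 0 < x.2 := hx
  have hy' : 0 < y.2 := hy
  refine Real.sqrt_le_sqrt ?_
  simp only [pbar, Prod.fst_sub, Prod.snd_sub]
  nlinarith [mul_pos hx' hy']

lemma norm_smul_perp_le (z : ℝ × ℝ) :
    ‖(2 * Real.pi * nrm z ^ 2)⁻¹ • perp z‖ ≤ 2⁻¹ * (nrm z)⁻¹ := by
  have hpi := Real.pi_gt_three
  rw [norm_smul, norm_perp, norm_inv, Real.norm_of_nonneg (by positivity)]
  rcases (nrm_nonneg z).eq_or_lt with h | h
  · simp [← h]
  · calc (2 * Real.pi * nrm z ^ 2)⁻¹ * ‖z‖ ≤ (2 * 1 * nrm z ^ 2)⁻¹ * nrm z := by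
          gcongr
          · linarith
          · exact norm_le_nrm z
      _ = 2⁻¹ * (nrm z)⁻¹ := by field_simp

lemma norm_Kker_le {x y : ℝ × ℝ} (hx : x ∈ Hplane) (hy : y ∈ Hplane) (hxy : x ≠ y) :
    ‖Kker x y‖ ≤ 1 + profile 1 ‖x - y‖ := by
  have hpos : 0 < ‖x - y‖ := norm_pos_iff.2 (sub_ne_zero.2 hxy)
  have h1 := norm_le_nrm (x - y)
  have h2 := nrm_sub_le_nrm_sub_pbar hx hy
  have h3 : (nrm (x - y))⁻¹ ≤ ‖x - y‖⁻¹ := by gcongr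
  have h4 : (nrm (x - pbar y))⁻¹ ≤ ‖x - y‖⁻¹ := by gcongr; linarith
  have h5 := inv_le_one_add_profile (norm_nonneg (x - y))
  have h6 := norm_sub_le ((2 * Real.pi * nrm (x - y) ^ 2)⁻¹ • perp (x - y))
    ((2 * Real.pi * nrm (x - pbar y) ^ 2)⁻¹ • perp (x - pbar y))
  have h7 := norm_smul_perp_le (x - y)
  have h8 := norm_smul_perp_le (x - pbar y)
  unfold Kker
  linarith

lemma abs_Kker_snd_le {x y : ℝ × ℝ} (hx : x ∈ Hplane) (hy : y ∈ Hplane) :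
    |(Kker x y).2| ≤ x.2 * (1 + profile x.2 ‖x - y‖) := by
  have hx' : 0 < x.2 := hx
  have hy' : 0 < y.2 := hy
  refine le_trans ?_ (mul_le_mul_of_nonneg_left
    (inv_mul_inv_max_le (ρ := x.2) (norm_nonneg (x - y))) hx'.le)
  have hpi := Real.pi_gt_three
  by_cases hxy : x = y
  · simp [hxy, Kker, perp, pbar]
  have hpos : 0 < ‖x - y‖ := norm_pos_iff.2 (sub_ne_zero.2 hxy)
  have h1 := norm_le_nrm (x - y)
  have h2 := nrm_sub_le_nrm_sub_pbar hx hy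
  have h3 : x.2 + y.2 ≤ nrm (x - pbar y) := by
    refine Real.le_sqrt_of_sq_le ?_
    simp [pbar]
    positivity
  set p := nrm (x - y) with hp
  set q := nrm (x - pbar y) with hq
  have hp0 : 0 < p := hpos.trans_le h1
  have hq0 : 0 < q := hp0.trans_le h2
  have hd : q ^ 2 - p ^ 2 = 4 * x.2 * y.2 := by
    rw [hp, hq, nrm_sq, nrm_sq]; simp [pbar]; ring
  have hz : |x.1 - y.1| ≤ p := by
    have := (norm_fst_le (x - y)).trans h1
    simpa using this
  have key : (Kker x y).2 = (x.1 - y.1) * (4 * x.2 * y.2) / (2 * Real.pi * p ^ 2 * q ^ 2) := by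
    rw [← hd]
    simp only [Kker, perp, pbar, Prod.snd_sub, Prod.smul_snd, Prod.fst_sub, smul_eq_mul]
    change (2 * Real.pi * p ^ 2)⁻¹ * (x.1 - y.1) - (2 * Real.pi * q ^ 2)⁻¹ * (x.1 - y.1) = _
    field_simp
  rw [key, abs_div, abs_mul, abs_of_pos (by positivity : 0 < 4 * x.2 * y.2),
    abs_of_pos (by positivity : 0 < 2 * Real.pi * p ^ 2 * q ^ 2)]
  have hmax : max ‖x - y‖ x.2 ≤ q := max_le (h1.trans h2) (by linarith)
  have hm0 : 0 < max ‖x - y‖ x.2 := lt_max_of_lt_left hpos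
  calc |x.1 - y.1| * (4 * x.2 * y.2) / (2 * Real.pi * p ^ 2 * q ^ 2)
      ≤ p * (4 * x.2 * q) / (2 * 2 * p ^ 2 * q ^ 2) := by
        gcongr <;> linarith
    _ = x.2 * (p⁻¹ * q⁻¹) := by field_simp; ring
    _ ≤ x.2 * (‖x - y‖⁻¹ * (max ‖x - y‖ x.2)⁻¹) := by gcongr

lemma measurable_nrm : Measurable nrm := by unfold nrm; fun_prop

lemma measurable_Kker : Measurable fun p : (ℝ × ℝ) × (ℝ × ℝ) => Kker p.1 p.2 := by
  have h := measurable_nrm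
  have hb : Measurable pbar := by unfold pbar; fun_prop
  have hp : Measurable perp := by unfold perp; fun_prop
  unfold Kker
  fun_prop

lemma contDiff_slice_left {g : ℝ → ℝ × ℝ → ℝ} {n : WithTop ℕ∞}
    (hg : ContDiff ℝ n fun q : ℝ × (ℝ × ℝ) => g q.1 q.2) (x : ℝ × ℝ) :
    ContDiff ℝ n fun t => g t x :=
  hg.comp (contDiff_id.prodMk contDiff_const)

lemma contDiff_slice_right {g : ℝ → ℝ × ℝ → ℝ} {n : WithTop ℕ∞}
    (hg : ContDiff ℝ n fun q : ℝ × (ℝ × ℝ) => g q.1 q.2) (t : ℝ) :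
    ContDiff ℝ n (g t) :=
  hg.comp (contDiff_const.prodMk contDiff_id)

/-- Differentiation under the integral over a compact set. -/
lemma hasDerivAt_setIntegral_of_contDiff {g : ℝ → ℝ × ℝ → ℝ}
    (hg : ContDiff ℝ 1 fun q : ℝ × (ℝ × ℝ) => g q.1 q.2) {K : Set (ℝ × ℝ)} (hK : IsCompact K)
    (t : ℝ) :
    HasDerivAt (fun t => ∫ x in K, g t x) (∫ x in K, deriv (fun s => g s x) t) t := by
  set G : ℝ × (ℝ × ℝ) → ℝ := fun q => g q.1 q.2 with hG
  have hd : ∀ s x, HasDerivAt (fun s => g s x) (fderiv ℝ G (s, x) (1, 0)) s := by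
    intro s x
    have h1 : HasFDerivAt G (fderiv ℝ G (s, x)) (s, x) :=
      (hg.differentiable one_ne_zero (s, x)).hasFDerivAt
    have h2 : HasDerivAt (fun s : ℝ => (s, x)) ((1 : ℝ), (0 : ℝ × ℝ)) s :=
      (hasDerivAt_id s).prodMk (hasDerivAt_const s x)
    exact h1.comp_hasDerivAt s h2
  have hcont : Continuous fun q : ℝ × (ℝ × ℝ) => fderiv ℝ G q (1, 0) :=
    (hg.continuous_fderiv one_ne_zero).clm_apply continuous_const
  have hslice : ∀ s, Continuous (g s) := fun s => (contDiff_slice_right hg s).continuous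
  obtain ⟨C, hC⟩ := ((isCompact_Icc (a := t - 1) (b := t + 1)).prod hK).exists_bound_of_continuousOn
    hcont.continuousOn
  have : (fun x => deriv (fun s => g s x) t) = fun x => fderiv ℝ G (t, x) (1, 0) :=
    funext fun x => (hd t x).deriv
  rw [this]
  have hfin : IsFiniteMeasure (volume.restrict K) := ⟨by simpa using hK.measure_lt_top⟩
  refine (hasDerivAt_integral_of_dominated_loc_of_deriv_le (s := Icc (t - 1) (t + 1))
    (F' := fun s x => fderiv ℝ G (s, x) (1, 0)) (bound := fun _ => C)
    (Icc_mem_nhds (by linarith) (by linarith)) ?_ ?_ ?_ ?_ ?_ ?_).2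
  · exact Eventually.of_forall fun s => (hslice s).aestronglyMeasurable
  · exact (hslice t).continuousOn.integrableOn_compact hK
  · exact (hcont.comp (by fun_prop : Continuous fun x : ℝ × ℝ => (t, x))).aestronglyMeasurable
  · refine (ae_restrict_iff' hK.measurableSet).2 (Eventually.of_forall fun x hx s hs => ?_)
    exact hC (s, x) ⟨hs, hx⟩
  · exact integrable_const C
  · exact Eventually.of_forall fun x s _ => hd s x

/-- `w` vanishes outside the closed ball of radius `n` about the origin. -/
def SuppLe (w : ℝ × ℝ → ℝ) (n : ℝ) : Prop := ∀ x, n < ‖x‖ → w x = 0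

lemma SuppLe.mono {w : ℝ × ℝ → ℝ} {n m : ℝ} (h : SuppLe w n) (hnm : n ≤ m) : SuppLe w m :=
  fun x hx => h x (hnm.trans_lt hx)

lemma SuppLe.hasCompactSupport {w : ℝ × ℝ → ℝ} {n : ℝ} (h : SuppLe w n) : HasCompactSupport w :=
  HasCompactSupport.intro (isCompact_closedBall (0 : ℝ × ℝ) n) fun x hx =>
    h x (by simpa using hx)

/-- Maximum principle for subsolutions of a transport equation. -/
lemma transport_max_principle {f : ℝ → ℝ × ℝ → ℝ} {v : ℝ → ℝ × ℝ → ℝ × ℝ} {a b N m : ℝ}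
    (hf : ContDiff ℝ 1 fun q : ℝ × (ℝ × ℝ) => f q.1 q.2)
    (hsupp : ∀ t ∈ Icc a b, SuppLe (f t) N)
    (htr : ∀ t ∈ Icc a b, ∀ x, deriv (fun s => f s x) t + fderiv ℝ (f t) x (v t x) ≤ 0)
    (hm : 0 ≤ m) (ha : ∀ x, f a x ≤ m) {t : ℝ} (ht : t ∈ Icc a b) (x : ℝ × ℝ) : f t x ≤ m := by
  by_contra! hlt
  have hat : a < t := by
    refine lt_of_le_of_ne ht.1 ?_
    rintro rfl
    exact absurd (ha x) (not_le.2 hlt)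
  have hta : 0 < t - a := sub_pos.2 hat
  set ε := (f t x - m) / (2 * (t - a)) with hε
  have hε0 : 0 < ε := div_pos (sub_pos.2 hlt) (by positivity)
  have hεt : ε * (t - a) = (f t x - m) / 2 := by rw [hε]; field_simp
  have hxN : x ∈ Metric.closedBall (0 : ℝ × ℝ) N := by
    by_contra h
    have := hsupp t ht x (by simpa using h)
    linarith
  obtain ⟨⟨t', x'⟩, ⟨ht', hx'⟩, hmax⟩ :=
    ((isCompact_Icc (a := a) (b := b)).prod (isCompact_closedBall (0 : ℝ × ℝ) N)).exists_isMaxOn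
      ⟨(t, x), ht, hxN⟩ (f := fun q : ℝ × (ℝ × ℝ) => f q.1 q.2 - ε * (q.1 - a))
      (hf.continuous.sub (by fun_prop)).continuousOn
  simp only at ht' hx'
  have hmax' : ∀ s ∈ Icc a b, ∀ y ∈ Metric.closedBall (0 : ℝ × ℝ) N,
      f s y - ε * (s - a) ≤ f t' x' - ε * (t' - a) := fun s hs y hy => isMaxOn_iff.1 hmax (s, y) ⟨hs, hy⟩
  have h1 := hmax' t ht x hxN
  have h2 : 0 ≤ ε * (t' - a) := mul_nonneg hε0.le (sub_nonneg.2 ht'.1)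
  have hbig : m < f t' x' := by linarith
  have hat' : a < t' := by
    refine lt_of_le_of_ne ht'.1 ?_
    rintro rfl
    exact absurd (ha x') (not_le.2 hbig)
  have hfd : fderiv ℝ (f t') x' = 0 := by
    refine IsLocalMax.fderiv_eq_zero (Eventually.of_forall fun y => ?_)
    by_cases hy : y ∈ Metric.closedBall (0 : ℝ × ℝ) N
    · have := hmax' t' ht' y hy
      linarith
    · rw [hsupp t' ht' y (by simpa using hy)]
      linarith
  have h3 := htr t' ht' x'
  rw [hfd] at h3
  simp only [zero_apply, add_zero] at h3
  have hder : HasDerivAt (fun s => f s x' - ε * (s - a))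
      (deriv (fun s => f s x') t' - ε * 1) t' :=
    (((contDiff_slice_left hf x').differentiable one_ne_zero) t').hasDerivAt.sub
      (((hasDerivAt_id t').sub_const a).const_mul ε)
  have hge : 0 ≤ deriv (fun s => f s x') t' - ε * 1 := by
    have htend := (hasDerivAt_iff_tendsto_slope.1 hder).mono_left
      (nhdsWithin_mono t' (fun s (hs : s ∈ Iio t') => (ne_of_lt hs : s ≠ t')))
    refine ge_of_tendsto htend ?_
    filter_upwards [Ioo_mem_nhdsLT hat'] with s hs
    have := hmax' s ⟨hs.1.le, hs.2.le.trans ht'.2⟩ x' hx'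
    rw [slope_def_field]
    exact div_nonneg_of_nonpos (by linarith) (by linarith [hs.2])
  linarith

/-- A smooth function supported in the half-plane and transported on the time interval `[a, b]` by
a vector field which is divergence free in the weak sense and controlled by the norms of `ω`. -/
structure FlowOn (ω : ℝ → ℝ × ℝ → ℝ) (u : ℝ → ℝ × ℝ → ℝ × ℝ) (a b : ℝ) : Prop where
  smooth : ContDiff ℝ 1 (fun q : ℝ × (ℝ × ℝ) => ω q.1 q.2)
  suppIn : ∀ t x, x ∉ Hplane → ω t x = 0
  transport : ∀ t ∈ Icc a b, ∀ x, deriv (fun s => ω s x) t + fderiv ℝ (ω t) x (u t x) = 0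
  div : ∀ t ∈ Icc a b, ∀ φ : ℝ → ℝ, ContDiff ℝ 1 φ → φ 0 = 0 →
    ∫ x, fderiv ℝ (φ ∘ ω t) x (u t x) = 0
  vel : ∀ t ∈ Icc a b, ∀ M L, (∀ x, |ω t x| ≤ M) → ∫ x, |ω t x| ≤ L →
    ∀ x ∈ Hplane, ‖u t x‖ ≤ L + 8 * M

namespace FlowOn

variable {ω : ℝ → ℝ × ℝ → ℝ} {u : ℝ → ℝ × ℝ → ℝ × ℝ} {a b : ℝ}

lemma mono (h : FlowOn ω u a b) {c d : ℝ} (hac : a ≤ c) (hdb : d ≤ b) : FlowOn ω u c d where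
  smooth := h.smooth
  suppIn := h.suppIn
  transport t ht := h.transport t (Icc_subset_Icc hac hdb ht)
  div t ht := h.div t (Icc_subset_Icc hac hdb ht)
  vel t ht := h.vel t (Icc_subset_Icc hac hdb ht)

/-- Time reversal. -/
lemma reverse (h : FlowOn ω u a b) :
    FlowOn (fun t => ω (-t)) (fun t x => -u (-t) x) (-b) (-a) where
  smooth := by
    have : ContDiff ℝ 1 fun q : ℝ × (ℝ × ℝ) => (-q.1, q.2) := by fun_prop
    exact h.smooth.comp this
  suppIn t x hx := h.suppIn (-t) x hx
  transport t ht x := by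
    have h1 := h.transport (-t) ⟨by linarith [ht.2], by linarith [ht.1]⟩ x
    have h2 := deriv_comp_neg (fun s => ω s x) t
    rw [h2, map_neg]
    linarith
  div t ht φ hφ h0 := by
    simp only [map_neg, integral_neg]
    rw [h.div (-t) ⟨by linarith [ht.2], by linarith [ht.1]⟩ φ hφ h0, neg_zero]
  vel t ht M L hM hL x hx := by
    rw [norm_neg]
    exact h.vel (-t) ⟨by linarith [ht.2], by linarith [ht.1]⟩ M L hM hL x hx

/-- Propagation of exponentially weighted bounds. -/
lemma sq_mul_exp_le (h : FlowOn ω u a b) {N : ℝ} (hN : ∀ t ∈ Icc a b, SuppLe (ω t) N)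
    (ℓ : ℝ × ℝ →L[ℝ] ℝ) {lam V n m : ℝ}
    (hV : ∀ t ∈ Icc a b, ∀ x ∈ Hplane, lam * (ℓ (u t x) - V) ≤ 0)
    (hm : ∀ x, ω a x ^ 2 * Real.exp (lam * (ℓ x - n)) ≤ m) {t : ℝ} (ht : t ∈ Icc a b)
    (x : ℝ × ℝ) : ω t x ^ 2 * Real.exp (lam * (ℓ x - n - V * (t - a))) ≤ m := by
  have hm0 : 0 ≤ m := le_trans (by positivity) (hm 0)
  refine transport_max_principle (N := N) (v := u) (b := b)
    (f := fun t x => ω t x ^ 2 * Real.exp (lam * (ℓ x - n - V * (t - a)))) ?_ ?_ ?_ hm0 ?_ ht x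
  · have := h.smooth
    fun_prop
  · intro t ht x hx
    simp [hN t ht x hx]
  · intro t ht x
    have hω1 : HasDerivAt (fun s => ω s x) (deriv (fun s => ω s x) t) t :=
      ((contDiff_slice_left h.smooth x).differentiable one_ne_zero t).hasDerivAt
    have hω2 : HasFDerivAt (ω t) (fderiv ℝ (ω t) x) x :=
      ((contDiff_slice_right h.smooth t).differentiable one_ne_zero x).hasFDerivAt
    have he1 : HasDerivAt (fun s => Real.exp (lam * (ℓ x - n - V * (s - a))))
        (Real.exp (lam * (ℓ x - n - V * (t - a))) * (lam * (-(V * 1)))) t :=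
      (((((hasDerivAt_id t).sub_const a).const_mul V).const_sub (ℓ x - n)).const_mul lam).exp
    have he2 : HasFDerivAt (fun y => Real.exp (lam * (ℓ y - n - V * (t - a))))
        (Real.exp (lam * (ℓ x - n - V * (t - a))) • (lam • ℓ)) x :=
      (((ℓ.hasFDerivAt.sub_const n).sub_const (V * (t - a))).const_mul lam).exp
    have e1 := ((hω1.pow 2).mul he1).deriv
    have e2 := ((hω2.pow 2).mul he2).fderiv
    have htr := h.transport t ht x
    have hsign : ω t x ^ 2 * (lam * (ℓ (u t x) - V)) ≤ 0 := by
      by_cases hx : x ∈ Hplane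
      · exact mul_nonpos_of_nonneg_of_nonpos (sq_nonneg _) (hV t ht x hx)
      · simp [h.suppIn t x hx]
    have hE := Real.exp_pos (lam * (ℓ x - n - V * (t - a)))
    set E := Real.exp (lam * (ℓ x - n - V * (t - a))) with hEdef
    have : deriv (fun s => ω s x ^ 2 * Real.exp (lam * (ℓ x - n - V * (s - a)))) t
        + fderiv ℝ (fun y => ω t y ^ 2 * Real.exp (lam * (ℓ y - n - V * (t - a)))) x (u t x)
        = E * (ω t x ^ 2 * (lam * (ℓ (u t x) - V))) := by
      have e1' : deriv (fun s => ω s x ^ 2 * Real.exp (lam * (ℓ x - n - V * (s - a)))) t = _ := e1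
      have e2' : fderiv ℝ (fun y => ω t y ^ 2 * Real.exp (lam * (ℓ y - n - V * (t - a)))) x
        = _ := e2
      rw [e1', e2']
      simp
      linear_combination (2 * ω t x * E) * htr
    rw [this]
    exact mul_nonpos_of_nonneg_of_nonpos hE.le hsign
  · intro x
    simpa using hm x

lemma abs_le_of_initial (h : FlowOn ω u a b) {N : ℝ} (hN : ∀ t ∈ Icc a b, SuppLe (ω t) N)
    {M : ℝ} (hM : ∀ x, |ω a x| ≤ M) {t : ℝ} (ht : t ∈ Icc a b) (x : ℝ × ℝ) : |ω t x| ≤ M := by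
  have hM0 : 0 ≤ M := (abs_nonneg _).trans (hM 0)
  have hM2 : ∀ y, ω a y ^ 2 ≤ M ^ 2 := fun y =>
    sq_le_sq' (by linarith [neg_abs_le (ω a y), hM y]) ((le_abs_self _).trans (hM y))
  have := h.sq_mul_exp_le hN 0 (lam := 0) (V := 0) (n := 0) (m := M ^ 2) (by simp)
    (fun y => by rw [zero_mul, Real.exp_zero, mul_one]; exact hM2 y) ht x
  rw [zero_mul, Real.exp_zero, mul_one] at this
  exact abs_le_of_sq_le_sq this hM0

/-- Finite speed of propagation in a given direction. -/
lemma eq_zero_of_lt (h : FlowOn ω u a b) {N : ℝ} (hN : ∀ t ∈ Icc a b, SuppLe (ω t) N)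
    (ℓ : ℝ × ℝ →L[ℝ] ℝ) (hℓ : ∀ z, ℓ z ≤ ‖z‖) {V n M : ℝ}
    (hV : ∀ t ∈ Icc a b, ∀ x ∈ Hplane, ‖u t x‖ ≤ V) (hM : ∀ x, |ω a x| ≤ M)
    (hn : SuppLe (ω a) n) {t : ℝ} (ht : t ∈ Icc a b) {x : ℝ × ℝ}
    (hx : n + V * (t - a) < ℓ x) : ω t x = 0 := by
  set d := ℓ x - n - V * (t - a) with hd
  have hd0 : 0 < d := by linarith
  by_contra hne
  have hsq : 0 < ω t x ^ 2 := by positivity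
  set lam := M ^ 2 / (ω t x ^ 2 * d) with hlam
  have hlam0 : 0 ≤ lam := by positivity
  have key := h.sq_mul_exp_le hN ℓ (lam := lam) (V := V) (n := n) (m := M ^ 2)
    (fun s hs y hy => mul_nonpos_of_nonneg_of_nonpos hlam0
      (by linarith [hℓ (u s y), hV s hs y hy])) ?_ ht x
  · have h1 : lam * d + 1 ≤ Real.exp (lam * d) := Real.add_one_le_exp _
    have h2 : ω t x ^ 2 * (lam * d) = M ^ 2 := by rw [hlam]; field_simp
    have h3 := mul_le_mul_of_nonneg_left h1 hsq.le
    rw [← hd] at key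
    nlinarith
  · intro y
    by_cases hy : n < ‖y‖
    · simp [hn y hy]
      positivity
    · have h1 : lam * (ℓ y - n) ≤ 0 :=
        mul_nonpos_of_nonneg_of_nonpos hlam0 (by linarith [hℓ y])
      have h2 : Real.exp (lam * (ℓ y - n)) ≤ 1 := Real.exp_le_one_iff.2 h1
      have h3 : ω a y ^ 2 ≤ M ^ 2 := sq_le_sq' (by linarith [neg_abs_le (ω a y), hM y])
        ((le_abs_self _).trans (hM y))
      calc ω a y ^ 2 * Real.exp (lam * (ℓ y - n)) ≤ M ^ 2 * 1 := by gcongr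
        _ = M ^ 2 := mul_one _

lemma suppLe_of_initial (h : FlowOn ω u a b) {N : ℝ} (hN : ∀ t ∈ Icc a b, SuppLe (ω t) N)
    {V n M : ℝ} (hV : ∀ t ∈ Icc a b, ∀ x ∈ Hplane, ‖u t x‖ ≤ V) (hM : ∀ x, |ω a x| ≤ M)
    (hn : SuppLe (ω a) n) {t : ℝ} (ht : t ∈ Icc a b) : SuppLe (ω t) (n + V * (t - a)) := by
  intro x hx
  rw [Prod.norm_def, lt_max_iff, Real.norm_eq_abs, Real.norm_eq_abs, lt_abs, lt_abs] at hx
  have hf : ∀ z : ℝ × ℝ, |z.1| ≤ ‖z‖ := norm_fst_le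
  have hs : ∀ z : ℝ × ℝ, |z.2| ≤ ‖z‖ := norm_snd_le
  rcases hx with (hx | hx) | (hx | hx)
  · exact h.eq_zero_of_lt hN (ContinuousLinearMap.fst ℝ ℝ ℝ)
      (fun z => (le_abs_self _).trans (hf z)) hV hM hn ht hx
  · exact h.eq_zero_of_lt hN (-ContinuousLinearMap.fst ℝ ℝ ℝ)
      (fun z => (neg_le_abs _).trans (hf z)) hV hM hn ht hx
  · exact h.eq_zero_of_lt hN (ContinuousLinearMap.snd ℝ ℝ ℝ)
      (fun z => (le_abs_self _).trans (hs z)) hV hM hn ht hx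
  · exact h.eq_zero_of_lt hN (-ContinuousLinearMap.snd ℝ ℝ ℝ)
      (fun z => (neg_le_abs _).trans (hs z)) hV hM hn ht hx

/-- Conservation of the integral of a function of `ω`. -/
lemma integral_comp_eq (h : FlowOn ω u a b) {N : ℝ} (hN : ∀ t ∈ Icc a b, SuppLe (ω t) N)
    {φ : ℝ → ℝ} (hφ : ContDiff ℝ 1 φ) (h0 : φ 0 = 0) {t : ℝ} (ht : t ∈ Icc a b) :
    ∫ x in Metric.closedBall (0 : ℝ × ℝ) N, φ (ω t x)
      = ∫ x in Metric.closedBall (0 : ℝ × ℝ) N, φ (ω a x) := by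
  have hg : ContDiff ℝ 1 fun q : ℝ × (ℝ × ℝ) => φ (ω q.1 q.2) := hφ.comp h.smooth
  have hd := hasDerivAt_setIntegral_of_contDiff (g := fun t x => φ (ω t x)) hg
    (isCompact_closedBall (0 : ℝ × ℝ) N)
  have hzero : ∀ t ∈ Icc a b,
      ∫ x in Metric.closedBall (0 : ℝ × ℝ) N, deriv (fun s => φ (ω s x)) t = 0 := by
    intro t ht
    have hpt : ∀ x, deriv (fun s => φ (ω s x)) t = -fderiv ℝ (φ ∘ ω t) x (u t x) := by
      intro x
      have hω1 : HasDerivAt (fun s => ω s x) (deriv (fun s => ω s x) t) t :=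
        ((contDiff_slice_left h.smooth x).differentiable one_ne_zero t).hasDerivAt
      have hω2 : HasFDerivAt (ω t) (fderiv ℝ (ω t) x) x :=
        ((contDiff_slice_right h.smooth t).differentiable one_ne_zero x).hasFDerivAt
      have hφ' : HasDerivAt φ (deriv φ (ω t x)) (ω t x) :=
        (hφ.differentiable one_ne_zero _).hasDerivAt
      have e1 : deriv (fun s => φ (ω s x)) t = _ := (hφ'.comp t hω1).deriv
      rw [e1, (hφ'.comp_hasFDerivAt x hω2).fderiv]
      have := h.transport t ht x
      simp
      linear_combination deriv φ (ω t x) * this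
    simp_rw [hpt]
    rw [integral_neg, setIntegral_eq_integral_of_forall_compl_eq_zero, h.div t ht φ hφ h0, neg_zero]
    intro x hx
    have : (φ ∘ ω t) =ᶠ[𝓝 x] fun _ => 0 := by
      filter_upwards [Metric.isClosed_closedBall.isOpen_compl.mem_nhds hx] with y hy
      simp [hN t ht y (by simpa using hy), h0]
    rw [this.fderiv_eq]
    simp
  refine constant_of_has_deriv_right_zero
    (f := fun t => ∫ x in Metric.closedBall (0 : ℝ × ℝ) N, φ (ω t x))
    (fun t _ => (hd t).continuousAt.continuousWithinAt) (fun t ht => ?_) t ht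
  have := (hd t).hasDerivWithinAt (s := Ici t)
  rwa [hzero t (Ico_subset_Icc_self ht)] at this

lemma integral_abs_le_of_initial (h : FlowOn ω u a b) {N : ℝ}
    (hN : ∀ t ∈ Icc a b, SuppLe (ω t) N) {t : ℝ} (ht : t ∈ Icc a b) :
    ∫ x, |ω t x| ≤ ∫ x, |ω a x| := by
  set B := Metric.closedBall (0 : ℝ × ℝ) N with hB
  have hBc : IsCompact B := isCompact_closedBall _ _
  have hcont : ∀ s, Continuous (ω s) := fun s => (contDiff_slice_right h.smooth s).continuous
  have hset : ∀ s ∈ Icc a b, ∫ x, |ω s x| = ∫ x in B, |ω s x| := fun s hs =>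
    (setIntegral_eq_integral_of_forall_compl_eq_zero fun x hx => by
      rw [hN s hs x (by simpa [hB] using hx), abs_zero]).symm
  have ha : a ∈ Icc a b := ⟨le_rfl, ht.1.trans ht.2⟩
  rw [hset t ht, hset a ha]
  refine le_of_forall_pos_le_add fun ε hε => ?_
  have hvol : 0 ≤ volume.real B := measureReal_nonneg
  set δ := ε / (volume.real B + 1) with hδ
  have hδ0 : 0 < δ := by positivity
  set φ : ℝ → ℝ := fun s => Real.sqrt (s ^ 2 + δ ^ 2) - δ with hφdef
  have hφ : ContDiff ℝ 1 φ := by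
    refine ContDiff.sub (ContDiff.sqrt (by fun_prop) fun s => ?_) contDiff_const
    positivity
  have hφ0 : φ 0 = 0 := by simp [hφdef, Real.sqrt_sq hδ0.le]
  have hlow : ∀ s, |s| - δ ≤ φ s := fun s => by
    have : |s| ≤ Real.sqrt (s ^ 2 + δ ^ 2) := Real.le_sqrt_of_sq_le (by rw [sq_abs]; nlinarith)
    simp only [hφdef]; linarith
  have hup : ∀ s, φ s ≤ |s| := fun s => by
    have : Real.sqrt (s ^ 2 + δ ^ 2) ≤ |s| + δ := by
      refine Real.sqrt_le_iff.2 ⟨by positivity, ?_⟩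
      nlinarith [sq_abs s, mul_nonneg (abs_nonneg s) hδ0.le]
    simp only [hφdef]; linarith
  have hi1 : ∀ s, IntegrableOn (fun x => |ω s x|) B := fun s =>
    (hcont s).abs.continuousOn.integrableOn_compact hBc
  have hi2 : ∀ s, IntegrableOn (fun x => φ (ω s x)) B := fun s =>
    (hφ.continuous.comp (hcont s)).continuousOn.integrableOn_compact hBc
  have hi3 : IntegrableOn (fun _ : ℝ × ℝ => δ) B :=
    continuous_const.continuousOn.integrableOn_compact hBc
  have h1 : ∫ x in B, |ω t x| ≤ ∫ x in B, (φ (ω t x) + δ) :=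
    integral_mono (hi1 t) ((hi2 t).add hi3) fun x => by
      have := hlow (ω t x)
      show |ω t x| ≤ φ (ω t x) + δ
      linarith
  have h2 : ∫ x in B, φ (ω a x) ≤ ∫ x in B, |ω a x| :=
    integral_mono (hi2 a) (hi1 a) fun x => hup _
  rw [integral_add (hi2 t) hi3, h.integral_comp_eq hN hφ hφ0 ht, setIntegral_const,
    smul_eq_mul] at h1
  have h3 : volume.real B * δ ≤ ε := by
    rw [hδ, mul_div_assoc', div_le_iff₀ (by positivity)]
    nlinarith
  linarith

/-- Propagation of all bounds forward in time. -/
lemma bounds (h : FlowOn ω u a b) {N : ℝ} (hN : ∀ t ∈ Icc a b, SuppLe (ω t) N) {M L n : ℝ}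
    (hM : ∀ x, |ω a x| ≤ M) (hL : ∫ x, |ω a x| ≤ L) (hn : SuppLe (ω a) n) {t : ℝ}
    (ht : t ∈ Icc a b) :
    (∀ x, |ω t x| ≤ M) ∧ ∫ x, |ω t x| ≤ L ∧ SuppLe (ω t) (n + (L + 8 * M) * (t - a)) := by
  have h1 : ∀ s ∈ Icc a b, ∀ x, |ω s x| ≤ M := fun s hs => h.abs_le_of_initial hN hM hs
  have h2 : ∀ s ∈ Icc a b, ∫ x, |ω s x| ≤ L := fun s hs =>
    (h.integral_abs_le_of_initial hN hs).trans hL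
  exact ⟨h1 t ht, h2 t ht, h.suppLe_of_initial hN
    (fun s hs x hx => h.vel s hs M L (h1 s hs) (h2 s hs) x hx) hM hn ht⟩

/-- Propagation of the support backward in time. -/
lemma suppLe_of_final (h : FlowOn ω u a b) {N : ℝ} (hN : ∀ t ∈ Icc a b, SuppLe (ω t) N)
    {M L n : ℝ} (hM : ∀ x, |ω b x| ≤ M) (hL : ∫ x, |ω b x| ≤ L) (hn : SuppLe (ω b) n) {t : ℝ}
    (ht : t ∈ Icc a b) : SuppLe (ω t) (n + (L + 8 * M) * (b - t)) := by
  have h1 := (h.reverse.bounds (N := N) (M := M) (L := L) (n := n) (t := -t)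
    (fun s hs => hN (-s) ⟨by linarith [hs.2], by linarith [hs.1]⟩) (by simpa using hM)
    (by simpa using hL) (by simpa using hn) ⟨by linarith [ht.2], by linarith [ht.1]⟩).2.2
  simp only [neg_neg] at h1
  convert h1 using 2
  ring

end FlowOn

lemma measurableSet_Hplane : MeasurableSet Hplane :=
  measurableSet_lt measurable_const measurable_snd

lemma integrable_profile_sub {ρ : ℝ} (hρ : 0 < ρ) (x : ℝ × ℝ) :
    Integrable (fun y : ℝ × ℝ => profile ρ ‖x - y‖) :=
  (integrable_profile_norm hρ).comp_sub_left x

lemma integrable_profile_sub_right {ρ : ℝ} (hρ : 0 < ρ) (y : ℝ × ℝ) :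
    Integrable (fun x : ℝ × ℝ => profile ρ ‖x - y‖) :=
  (integrable_profile_norm hρ).comp_sub_right y

section BiotSavart

variable {w : ℝ × ℝ → ℝ} {M L : ℝ}

lemma integrable_abs_add_profile (hw : Integrable w) {ρ : ℝ} (hρ : 0 < ρ) (x : ℝ × ℝ) :
    Integrable fun y => |w y| + M * profile ρ ‖x - y‖ :=
  hw.abs.add ((integrable_profile_sub hρ x).const_mul M)

lemma abs_mul_one_add_profile_le (hM : ∀ x, |w x| ≤ M) (ρ : ℝ) (x y : ℝ × ℝ) :
    |w y| * (1 + profile ρ ‖x - y‖) ≤ |w y| + M * profile ρ ‖x - y‖ := by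
  nlinarith [mul_le_mul_of_nonneg_right (hM y) (profile_nonneg (ρ := ρ) (norm_nonneg (x - y)))]

lemma setIntegral_abs_add_profile_le (hw : Integrable w) (hM : ∀ x, |w x| ≤ M)
    (hL : ∫ x, |w x| ≤ L) {ρ : ℝ} (hρ : 0 < ρ) (x : ℝ × ℝ) :
    ∫ y in Hplane, (|w y| + M * profile ρ ‖x - y‖) ≤ L + 8 * M * (1 + |Real.log ρ|) := by
  have hM0 : 0 ≤ M := (abs_nonneg _).trans (hM 0)
  refine (setIntegral_le_integral (integrable_abs_add_profile hw hρ x)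
    (Eventually.of_forall fun y => ?_)).trans ?_
  · exact add_nonneg (abs_nonneg _) (mul_nonneg hM0 (profile_nonneg (norm_nonneg _)))
  · rw [integral_add hw.abs ((integrable_profile_sub hρ x).const_mul M), integral_const_mul,
      integral_sub_left_eq_self (fun z : ℝ × ℝ => profile ρ ‖z‖) volume x]
    have := mul_le_mul_of_nonneg_left (integral_profile_norm_le hρ) hM0
    linarith

lemma ae_norm_smul_Kker_le (hM : ∀ x, |w x| ≤ M) {x : ℝ × ℝ} (hx : x ∈ Hplane) :
    ∀ᵐ y ∂volume.restrict Hplane, ‖w y • Kker x y‖ ≤ |w y| + M * profile 1 ‖x - y‖ := by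
  have hne : ∀ᵐ y ∂volume.restrict Hplane, y ≠ x :=
    ae_restrict_of_ae (compl_mem_ae_iff.2 (measure_singleton x))
  filter_upwards [ae_restrict_mem measurableSet_Hplane, hne] with y hy hyx
  rw [norm_smul, Real.norm_eq_abs]
  exact (mul_le_mul_of_nonneg_left (norm_Kker_le hx hy hyx.symm) (abs_nonneg _)).trans
    (abs_mul_one_add_profile_le hM 1 x y)

lemma integrableOn_smul_Kker (hwc : Continuous w) (hw : Integrable w) (hM : ∀ x, |w x| ≤ M)
    {x : ℝ × ℝ} (hx : x ∈ Hplane) : IntegrableOn (fun y => w y • Kker x y) Hplane := by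
  refine Integrable.mono' (integrable_abs_add_profile (M := M) hw one_pos x).integrableOn ?_
    (ae_norm_smul_Kker_le hM hx)
  exact (hwc.measurable.smul (measurable_Kker.comp measurable_prodMk_left)).aestronglyMeasurable

lemma norm_biotSavart_le (hw : Integrable w) (hM : ∀ x, |w x| ≤ M) (hL : ∫ x, |w x| ≤ L)
    {x : ℝ × ℝ} (hx : x ∈ Hplane) : ‖∫ y in Hplane, w y • Kker x y‖ ≤ L + 8 * M := by
  have := (norm_integral_le_of_norm_le
    (integrable_abs_add_profile (M := M) hw one_pos x).integrableOn
    (ae_norm_smul_Kker_le hM hx)).trans (setIntegral_abs_add_profile_le hw hM hL one_pos x)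
  simpa using this

/-- Log-Lipschitz bound for the normal velocity near the boundary. -/
lemma abs_biotSavart_snd_le (hwc : Continuous w) (hw : Integrable w) (hM : ∀ x, |w x| ≤ M)
    (hL : ∫ x, |w x| ≤ L) {x : ℝ × ℝ} (hx : x ∈ Hplane) :
    |(∫ y in Hplane, w y • Kker x y).2| ≤ x.2 * (L + 8 * M * (1 + |Real.log x.2|)) := by
  have hx' : 0 < x.2 := hx
  rw [snd_integral (integrableOn_smul_Kker hwc hw hM hx), ← Real.norm_eq_abs]
  refine (norm_integral_le_of_norm_le
    ((integrable_abs_add_profile (M := M) hw hx' x).const_mul x.2).integrableOn ?_).trans ?_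
  · refine ae_restrict_of_forall_mem measurableSet_Hplane fun y hy => ?_
    rw [Prod.smul_snd, norm_smul, Real.norm_eq_abs, Real.norm_eq_abs]
    refine (mul_le_mul_of_nonneg_left (abs_Kker_snd_le hx hy) (abs_nonneg _)).trans ?_
    have := mul_le_mul_of_nonneg_left (abs_mul_one_add_profile_le hM x.2 x y) hx'.le
    linarith
  · rw [integral_const_mul]
    exact mul_le_mul_of_nonneg_left (setIntegral_abs_add_profile_le hw hM hL hx' x) hx'.le

/-- The full-plane Biot–Savart kernel is divergence free in the weak sense. -/
lemma integral_fderiv_perp_eq_zero {ψ : ℝ × ℝ → ℝ} (hψ : ContDiff ℝ 1 ψ) (p : ℝ × ℝ) :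
    ∫ x, fderiv ℝ ψ x ((2 * Real.pi * nrm (x - p) ^ 2)⁻¹ • perp (x - p)) = 0 := by
  have htrans := integral_add_right_eq_self (μ := volume)
    (fun x => fderiv ℝ ψ x ((2 * Real.pi * nrm (x - p) ^ 2)⁻¹ • perp (x - p))) p
  rw [← htrans, ← integral_comp_polarCoord_symm]
  simp only [add_sub_cancel_right]
  set F : ℝ × ℝ → ℝ := fun q => q.1 • fderiv ℝ ψ (polarCoord.symm q + p)
    ((2 * Real.pi * nrm (polarCoord.symm q) ^ 2)⁻¹ • perp (polarCoord.symm q)) with hF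
  by_cases hint : IntegrableOn F polarCoord.target
  swap
  · exact integral_undef hint
  have htar : polarCoord.target = Ioi (0 : ℝ) ×ˢ Ioo (-Real.pi) Real.pi := rfl
  rw [htar] at hint ⊢
  rw [Measure.volume_eq_prod] at hint ⊢
  rw [setIntegral_prod _ hint]
  refine setIntegral_eq_zero_of_forall_eq_zero fun r _ => ?_
  set γ : ℝ → ℝ × ℝ := fun θ => (r * Real.cos θ, r * Real.sin θ) + p with hγ
  have hγ1 : ContDiff ℝ 1 γ := by fun_prop
  have hγd : ∀ θ, HasDerivAt γ (perp (r * Real.cos θ, r * Real.sin θ)) θ := by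
    intro θ
    have h1 := (Real.hasDerivAt_cos θ).const_mul r
    have h2 := (Real.hasDerivAt_sin θ).const_mul r
    refine ((h1.prodMk h2).add_const p).congr_deriv ?_
    simp [perp]
  have hd : ∀ θ, HasDerivAt (ψ ∘ γ)
      (fderiv ℝ ψ (γ θ) (perp (r * Real.cos θ, r * Real.sin θ))) θ := fun θ =>
    ((hψ.differentiable one_ne_zero _).hasFDerivAt).comp_hasDerivAt θ (hγd θ)
  have hFeq : ∀ θ, F (r, θ) = r * (2 * Real.pi * r ^ 2)⁻¹ * deriv (ψ ∘ γ) θ := by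
    intro θ
    have hn : nrm (r * Real.cos θ, r * Real.sin θ) ^ 2 = r ^ 2 := by
      rw [nrm_sq]
      linear_combination r ^ 2 * Real.cos_sq_add_sin_sq θ
    rw [(hd θ).deriv]
    simp only [hF, polarCoord_symm_apply, hn, map_smul, smul_eq_mul, hγ]
    ring
  have hpi := Real.pi_pos
  simp_rw [hFeq]
  rw [integral_const_mul, ← integral_Ioc_eq_integral_Ioo,
    ← intervalIntegral.integral_of_le (by linarith),
    intervalIntegral.integral_deriv_eq_sub (fun θ _ => (hd θ).differentiableAt)
      ((hψ.comp hγ1).continuous_deriv le_rfl |>.intervalIntegrable _ _)]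
  simp [hγ]

lemma integrable_fderiv_perp {ψ : ℝ × ℝ → ℝ} (hψ : ContDiff ℝ 1 ψ) (hψc : HasCompactSupport ψ)
    (p : ℝ × ℝ) :
    Integrable fun x => fderiv ℝ ψ x ((2 * Real.pi * nrm (x - p) ^ 2)⁻¹ • perp (x - p)) := by
  have hc := hψ.continuous_fderiv one_ne_zero
  have hcs := hψc.fderiv (𝕜 := ℝ)
  obtain ⟨C, hC⟩ := hcs.exists_bound_of_continuous hc
  refine Integrable.mono' ((hc.integrable_of_hasCompactSupport hcs).norm.add
    ((integrable_profile_sub_right one_pos p).const_mul C)) ?_ (Eventually.of_forall fun x => ?_)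
  · have h := measurable_nrm
    have hp : Measurable perp := by unfold perp; fun_prop
    have hm : Measurable fun x => (2 * Real.pi * nrm (x - p) ^ 2)⁻¹ • perp (x - p) := by fun_prop
    exact isBoundedBilinearMap_apply.continuous.comp_stronglyMeasurable
      (hc.stronglyMeasurable.prodMk hm.stronglyMeasurable) |>.aestronglyMeasurable
  · have h1 := (fderiv ℝ ψ x).le_opNorm ((2 * Real.pi * nrm (x - p) ^ 2)⁻¹ • perp (x - p))
    have h2 : ‖(2 * Real.pi * nrm (x - p) ^ 2)⁻¹ • perp (x - p)‖ ≤ 1 + profile 1 ‖x - p‖ := by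
      refine (norm_smul_perp_le _).trans (le_trans ?_ (inv_le_one_add_profile (norm_nonneg _)))
      rcases (norm_nonneg (x - p)).eq_or_lt with h | h
      · have : x - p = 0 := norm_eq_zero.1 h.symm
        simp [this, nrm]
      · have h3 := norm_le_nrm (x - p)
        have h4 : (nrm (x - p))⁻¹ ≤ ‖x - p‖⁻¹ := by gcongr
        have h5 : 0 ≤ (nrm (x - p))⁻¹ := inv_nonneg.2 (nrm_nonneg _)
        linarith
    have h3 := mul_le_mul_of_nonneg_left h2 (norm_nonneg (fderiv ℝ ψ x))
    have h4 := mul_le_mul_of_nonneg_right (hC x) (profile_nonneg (ρ := 1) (norm_nonneg (x - p)))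
    simp only [Pi.add_apply]
    linarith

lemma integral_fderiv_Kker_eq_zero {ψ : ℝ × ℝ → ℝ} (hψ : ContDiff ℝ 1 ψ)
    (hψc : HasCompactSupport ψ) (y : ℝ × ℝ) : ∫ x, fderiv ℝ ψ x (Kker x y) = 0 := by
  simp only [Kker, map_sub]
  rw [integral_sub (integrable_fderiv_perp hψ hψc y) (integrable_fderiv_perp hψ hψc (pbar y)),
    integral_fderiv_perp_eq_zero hψ, integral_fderiv_perp_eq_zero hψ, sub_zero]

lemma ae_prod_ne (ν : Measure (ℝ × ℝ)) [SFinite ν] :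
    ∀ᵐ q ∂(volume : Measure (ℝ × ℝ)).prod ν, q.1 ≠ q.2 := by
  have hs : MeasurableSet {q : (ℝ × ℝ) × (ℝ × ℝ) | q.1 ≠ q.2} :=
    (measurableSet_eq_fun measurable_fst measurable_snd).compl
  have h : ∀ᵐ q ∂ν.prod (volume : Measure (ℝ × ℝ)), q.2 ≠ q.1 := by
    refine (Measure.ae_prod_iff_ae_ae
      (measurableSet_eq_fun measurable_snd measurable_fst).compl).2 ?_
    exact Eventually.of_forall fun y => compl_mem_ae_iff.2 (measure_singleton y)
  rw [← Measure.prod_swap, ae_map_iff measurable_swap.aemeasurable hs]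
  exact h

/-- The velocity recovered by the Biot–Savart law is divergence free in the weak sense. -/
lemma integral_fderiv_biotSavart_eq_zero {ψ : ℝ × ℝ → ℝ} (hw : Continuous w)
    (hwc : HasCompactSupport w) (hψ : ContDiff ℝ 1 ψ) (hψc : HasCompactSupport ψ)
    (hψH : tsupport ψ ⊆ Hplane) :
    ∫ x, fderiv ℝ ψ x (∫ y in Hplane, w y • Kker x y) = 0 := by
  have hwi : Integrable w := hw.integrable_of_hasCompactSupport hwc
  obtain ⟨M, hM⟩ := hwc.exists_bound_of_continuous hw
  have hc := hψ.continuous_fderiv one_ne_zero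
  have hcs := hψc.fderiv (𝕜 := ℝ)
  obtain ⟨C, hC⟩ := hcs.exists_bound_of_continuous hc
  have hout : ∀ x, x ∉ Hplane → fderiv ℝ ψ x = 0 := fun x hx => by
    by_contra hne
    exact hx (hψH (support_fderiv_subset ℝ hne))
  have hcomm : ∀ x, fderiv ℝ ψ x (∫ y in Hplane, w y • Kker x y)
      = ∫ y in Hplane, fderiv ℝ ψ x (w y • Kker x y) := by
    intro x
    by_cases hx : x ∈ Hplane
    · exact ((fderiv ℝ ψ x).integral_comp_comm (integrableOn_smul_Kker hw hwi hM hx)).symm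
    · simp [hout x hx]
  simp_rw [hcomm]
  rw [integral_integral_swap]
  · simp only [map_smul, integral_smul, integral_fderiv_Kker_eq_zero hψ hψc, smul_zero,
      integral_zero]
  have hdom : Integrable (fun q : (ℝ × ℝ) × (ℝ × ℝ) => ‖fderiv ℝ ψ q.1‖ * |w q.2|
      + C * (|w q.2| * profile 1 ‖q.1 - q.2‖)) (volume.prod (volume.restrict Hplane)) := by
    refine ((hc.integrable_of_hasCompactSupport hcs).norm.mul_prod hwi.abs.integrableOn).add ?_
    exact ((hwi.abs.integrableOn (s := Hplane)).convolution_integrand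
      (ContinuousLinearMap.mul ℝ ℝ) (integrable_profile_norm one_pos)).const_mul C
  refine hdom.mono' ?_ ?_
  · exact isBoundedBilinearMap_apply.continuous.comp_stronglyMeasurable
      ((hc.comp continuous_fst).stronglyMeasurable.prodMk
        ((hw.measurable.comp measurable_snd).smul measurable_Kker).stronglyMeasurable)
      |>.aestronglyMeasurable
  · have hmem : ∀ᵐ q ∂(volume : Measure (ℝ × ℝ)).prod (volume.restrict Hplane), q.2 ∈ Hplane :=
      Measure.quasiMeasurePreserving_snd.ae (ae_restrict_mem measurableSet_Hplane)
    filter_upwards [hmem, ae_prod_ne (volume.restrict Hplane)] with q hq hne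
    simp only [Function.uncurry]
    have hp := profile_nonneg (ρ := 1) (norm_nonneg (q.1 - q.2))
    have hC0 : 0 ≤ C := (norm_nonneg _).trans (hC 0)
    by_cases hx : q.1 ∈ Hplane
    · have h1 := (fderiv ℝ ψ q.1).le_opNorm (w q.2 • Kker q.1 q.2)
      rw [norm_smul, Real.norm_eq_abs (w q.2)] at h1
      have h2 := norm_Kker_le hx hq hne
      calc _ ≤ ‖fderiv ℝ ψ q.1‖ * (|w q.2| * ‖Kker q.1 q.2‖) := h1
        _ ≤ ‖fderiv ℝ ψ q.1‖ * (|w q.2| * (1 + profile 1 ‖q.1 - q.2‖)) := by gcongr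
        _ = ‖fderiv ℝ ψ q.1‖ * |w q.2|
            + ‖fderiv ℝ ψ q.1‖ * (|w q.2| * profile 1 ‖q.1 - q.2‖) := by ring
        _ ≤ _ := by
          gcongr
          exact hC q.1
    · rw [hout _ hx]
      simp
      positivity

end BiotSavart

lemma IsEulerSol.flowOn {ω : ℝ → ℝ × ℝ → ℝ} {u : ℝ → ℝ × ℝ → ℝ × ℝ} (h : IsEulerSol ω u)
    {a b : ℝ} (ha : 0 ≤ a) : FlowOn ω u a b := by
  have hsm : ContDiff ℝ 1 fun q : ℝ × (ℝ × ℝ) => ω q.1 q.2 := h.smooth.of_le (by simp)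
  have hcont : ∀ t, Continuous (ω t) := fun t => (contDiff_slice_right hsm t).continuous
  have hout : ∀ t x, x ∉ Hplane → ω t x = 0 := fun t x hx =>
    image_eq_zero_of_notMem_tsupport fun hx' => hx (h.suppIn t hx')
  refine ⟨hsm, hout, ?_, ?_, ?_⟩
  · intro t ht x
    by_cases hx : x ∈ Hplane
    · exact h.transport t (ha.trans ht.1) x hx
    · have h1 : fderiv ℝ (ω t) x = 0 := by
        by_contra hne
        exact hx (h.suppIn t (support_fderiv_subset ℝ hne))
      have h2 : (fun s => ω s x) = fun _ => 0 := funext fun s => hout s x hx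
      rw [h1, h2]
      simp
  · intro t _ φ hφ h0
    simp_rw [h.biotSavart t]
    refine integral_fderiv_biotSavart_eq_zero (hcont t) (h.compactSupp t)
      (hφ.comp (contDiff_slice_right hsm t)) ((h.compactSupp t).comp_left h0) ?_
    refine (closure_mono fun x hx => ?_).trans (h.suppIn t)
    intro hzero
    exact hx (by simp [hzero, h0])
  · intro t _ M L hM hL x hx
    rw [h.biotSavart t]
    exact norm_biotSavart_le ((hcont t).integrable_of_hasCompactSupport (h.compactSupp t)) hM hL hx

lemma FlowOn.exists_suppLe_of_forall_Ioc {ω : ℝ → ℝ × ℝ → ℝ} {u : ℝ → ℝ × ℝ → ℝ × ℝ} {c t : ℝ}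
    (h : FlowOn ω u c t) (hc : ∀ s, ∃ n, SuppLe (ω s) n)
    (hloc : ∀ s ∈ Ioc c t, ∃ N, ∀ r ∈ Icc s t, SuppLe (ω r) N) :
    ∃ N, ∀ r ∈ Icc c t, SuppLe (ω r) N := by
  obtain ⟨n, hn⟩ := hc t
  obtain ⟨m, hm⟩ := hc c
  obtain ⟨M, hM⟩ := hn.hasCompactSupport.exists_bound_of_continuous
    (contDiff_slice_right h.smooth t).continuous
  have hM0 : 0 ≤ M := (norm_nonneg _).trans (hM 0)
  set L := ∫ x, |ω t x| with hL
  have hL0 : 0 ≤ L := integral_nonneg fun x => abs_nonneg _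
  refine ⟨max m (n + (L + 8 * M) * (t - c)), fun r hr => ?_⟩
  rcases hr.1.eq_or_lt with rfl | hlt
  · exact hm.mono (le_max_left _ _)
  · obtain ⟨N, hN⟩ := hloc r ⟨hlt, hr.2⟩
    refine ((h.mono hr.1 le_rfl).suppLe_of_final hN hM hL.ge hn
      (left_mem_Icc.2 hr.2)).mono (le_trans ?_ (le_max_right _ _))
    gcongr

/-- A Baire category argument shows that pointwise compactness of the supports of a transported
function upgrades to compactness locally uniformly in time. -/
lemma exists_suppLe_Icc {ω : ℝ → ℝ × ℝ → ℝ} {u : ℝ → ℝ × ℝ → ℝ × ℝ}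
    (h : ∀ a b, 0 ≤ a → FlowOn ω u a b) (hc : ∀ s, ∃ n, SuppLe (ω s) n) (T : ℝ) :
    ∃ N, ∀ t ∈ Icc 0 T, SuppLe (ω t) N := by
  have hsm := (h 0 0 le_rfl).smooth
  set G : Set ℝ := {t | ∃ n, ∀ᶠ s in 𝓝 t, 0 ≤ s → SuppLe (ω s) n} with hG
  have hGo : IsOpen G := isOpen_iff_mem_nhds.2 fun t ⟨n, hn⟩ =>
    (eventually_eventually_nhds.2 hn).mono fun s hs => ⟨n, hs⟩
  have hcpt : ∀ K : Set ℝ, IsCompact K → K ⊆ G → ∃ n, ∀ s ∈ K, 0 ≤ s → SuppLe (ω s) n := by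
    intro K hK hKG
    refine hK.induction_on (p := fun K => ∃ n, ∀ s ∈ K, 0 ≤ s → SuppLe (ω s) n)
      ⟨0, by simp⟩ ?_ ?_ ?_
    · rintro s t hst ⟨n, hn⟩
      exact ⟨n, fun r hr => hn r (hst hr)⟩
    · rintro s t ⟨n, hn⟩ ⟨m, hm⟩
      refine ⟨max n m, fun r hr h0 => ?_⟩
      rcases hr with hr | hr
      · exact (hn r hr h0).mono (le_max_left _ _)
      · exact (hm r hr h0).mono (le_max_right _ _)
    · intro t ht
      obtain ⟨n, hn⟩ := hKG ht
      exact ⟨_, mem_nhdsWithin_of_mem_nhds hn, n, fun s hs => hs⟩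
  suffices hall : ∀ t, t ∈ G by
    obtain ⟨N, hN⟩ := hcpt (Icc 0 T) isCompact_Icc fun t _ => hall t
    exact ⟨N, fun t ht => hN t ht ht.1⟩
  by_contra! hne
  obtain ⟨t₀, ht₀⟩ := hne
  have hFc : IsClosed Gᶜ := hGo.isClosed_compl
  have : Nonempty ↥Gᶜ := ⟨⟨t₀, ht₀⟩⟩
  have : CompleteSpace ↥Gᶜ := hFc.completeSpace_coe
  obtain ⟨n, ⟨p, hp⟩, hpn⟩ := nonempty_interior_of_iUnion_of_closed
    (f := fun n : ℕ => {t : ↥Gᶜ | SuppLe (ω t) n}) (fun n => by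
      simp only [SuppLe, ofPred_forall]
      refine isClosed_iInter fun x => isClosed_iInter fun _ => ?_
      exact isClosed_eq ((contDiff_slice_left hsm x).continuous.comp continuous_subtype_val)
        continuous_const) (by
      refine eq_univ_of_forall fun t => mem_iUnion.2 ?_
      obtain ⟨r, hr⟩ := hc t
      exact ⟨⌈r⌉₊, hr.mono (Nat.le_ceil r)⟩)
  rw [mem_interior_iff_mem_nhds, Metric.mem_nhds_iff] at hpn
  obtain ⟨δ, hδ, hball⟩ := hpn
  have hbdd : ∀ t ∈ Gᶜ, |t - p| < δ → SuppLe (ω t) n := fun t ht htp =>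
    hball (show (⟨t, ht⟩ : ↥Gᶜ) ∈ Metric.ball (⟨p, hp⟩ : ↥Gᶜ) δ from by
      rw [Metric.mem_ball, Subtype.dist_eq, Real.dist_eq]
      exact htp)
  have hp0 : 0 ≤ p := by
    by_contra! hlt
    refine hp ⟨0, ?_⟩
    filter_upwards [Iio_mem_nhds hlt] with s hs h0
    exact absurd h0 (not_le.2 hs)
  set a := max 0 (p - δ / 2) with ha
  set b := p + δ / 2 with hb
  have ha0 : 0 ≤ a := le_max_left _ _
  have hap : a ≤ p := max_le hp0 (by linarith)
  have hpa : p - δ / 2 ≤ a := le_max_right _ _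
  have hab : a ≤ b := by linarith
  obtain ⟨m, hm⟩ := hc a
  set n' := max (n : ℝ) m with hn'
  obtain ⟨M, hM⟩ := ((isCompact_Icc (a := a) (b := b)).prod
    (isCompact_closedBall (0 : ℝ × ℝ) n')).exists_bound_of_continuousOn hsm.continuous.continuousOn
  set B := Metric.closedBall (0 : ℝ × ℝ) n' with hB
  set M' := max M 0 with hM'
  have hM0 : 0 ≤ M' := le_max_right _ _
  set L := M' * volume.real B with hL
  have hL0 : 0 ≤ L := mul_nonneg hM0 measureReal_nonneg
  have hb1 : ∀ c ∈ Icc a b, SuppLe (ω c) n' → ∀ x, |ω c x| ≤ M' := by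
    intro c hcab hcn x
    by_cases hx : x ∈ B
    · exact (hM (c, x) ⟨hcab, hx⟩).trans (le_max_left _ _)
    · rw [hcn x (by simpa [hB] using hx), abs_zero]
      exact hM0
  have hb2 : ∀ c ∈ Icc a b, SuppLe (ω c) n' → ∫ x, |ω c x| ≤ L := by
    intro c hcab hcn
    rw [← setIntegral_eq_integral_of_forall_compl_eq_zero (s := B) fun x hx => by
      rw [hcn x (by simpa [hB] using hx), abs_zero]]
    refine (le_abs_self _).trans ?_
    have key : ‖∫ x in B, |ω c x|‖ ≤ M' * volume.real B :=
      norm_setIntegral_le_of_norm_le_const (isCompact_closedBall (0 : ℝ × ℝ) n').measure_lt_top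
        fun x _ => by simpa using hb1 c hcab hcn x
    exact key
  have hgood : ∀ t ∈ Icc a b, SuppLe (ω t) (n' + (L + 8 * M') * (b - a)) := by
    intro t ht
    have hKc : IsCompact (Icc a t ∩ (Gᶜ ∪ {a})) :=
      isCompact_Icc.inter_right (hFc.union isClosed_singleton)
    obtain ⟨c, ⟨⟨hac, hct⟩, hcG⟩, hmax⟩ := hKc.exists_isGreatest
      ⟨a, left_mem_Icc.2 ht.1, Or.inr rfl⟩
    have hcab : c ∈ Icc a b := ⟨hac, hct.trans ht.2⟩
    have hcn : SuppLe (ω c) n' := by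
      rcases hcG with hcG | rfl
      · refine (hbdd c hcG ?_).mono (le_max_left _ _)
        rw [abs_lt]
        constructor <;> linarith [hcab.2]
      · exact hm.mono (le_max_right _ _)
    have hflow := h c t (ha0.trans hac)
    obtain ⟨N, hN⟩ := hflow.exists_suppLe_of_forall_Ioc hc (by
      intro s hs
      obtain ⟨N, hN⟩ := hcpt (Icc s t) isCompact_Icc (by
        intro r hr
        by_contra hrG
        have := hmax ⟨⟨hac.trans (hs.1.le.trans hr.1), hr.2⟩, Or.inl hrG⟩
        linarith [hs.1, hr.1])
      exact ⟨N, fun r hr => hN r hr (ha0.trans (hac.trans (hs.1.le.trans hr.1)))⟩)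
    refine ((hflow.bounds hN (hb1 c hcab hcn) (hb2 c hcab hcn) hcn
      (right_mem_Icc.2 hct)).2.2).mono ?_
    gcongr
    exact ht.2
  refine hp ⟨n' + (L + 8 * M') * (b - a), ?_⟩
  filter_upwards [Icc_mem_nhds (show p - δ / 2 < p by linarith) (show p < b by linarith)]
    with s hs h0
  exact hgood s ⟨max_le h0 hs.1, hs.2⟩

lemma IsEulerSol.bounds {ω : ℝ → ℝ × ℝ → ℝ} {u : ℝ → ℝ × ℝ → ℝ × ℝ} (h : IsEulerSol ω u)
    {A B : ℝ} (hA : ∫ y in Hplane, |ω 0 y| ≤ A) (hB : ∀ y, |ω 0 y| ≤ B) {t : ℝ} (ht : 0 ≤ t) :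
    (∀ x, |ω t x| ≤ B) ∧ ∫ x, |ω t x| ≤ A := by
  have hflow : ∀ a b, 0 ≤ a → FlowOn ω u a b := fun a b ha => h.flowOn ha
  have hc : ∀ s, ∃ n, SuppLe (ω s) n := fun s => by
    obtain ⟨n, hn⟩ := (h.compactSupp s).isCompact.isBounded.subset_closedBall 0
    refine ⟨n, fun x hx => image_eq_zero_of_notMem_tsupport fun hx' => ?_⟩
    have := hn hx'
    rw [mem_closedBall_zero_iff] at this
    linarith
  obtain ⟨N, hN⟩ := exists_suppLe_Icc hflow hc t
  obtain ⟨n, hn⟩ := hc 0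
  have hA' : ∫ y, |ω 0 y| ≤ A := by
    rwa [← setIntegral_eq_integral_of_forall_compl_eq_zero (s := Hplane) fun x hx => by
      rw [(hflow 0 t le_rfl).suppIn 0 x hx, abs_zero]]
  obtain ⟨h1, h2, -⟩ := (hflow 0 t le_rfl).bounds hN hB hA' hn (right_mem_Icc.2 ht)
  exact ⟨h1, h2⟩

lemma IsEulerSol.abs_velocity_snd_le {ω : ℝ → ℝ × ℝ → ℝ} {u : ℝ → ℝ × ℝ → ℝ × ℝ}
    (h : IsEulerSol ω u) {A B : ℝ} (hA : ∫ y in Hplane, |ω 0 y| ≤ A) (hB : ∀ y, |ω 0 y| ≤ B)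
    {t : ℝ} (ht : 0 ≤ t) {x : ℝ × ℝ} (hx : x ∈ Hplane) :
    |(u t x).2| ≤ x.2 * (A + 8 * B * (1 + |Real.log x.2|)) := by
  obtain ⟨h1, h2⟩ := h.bounds hA hB ht
  have hcont : Continuous (ω t) := (contDiff_slice_right h.smooth t).continuous
  rw [h.biotSavart t x]
  exact abs_biotSavart_snd_le hcont
    (hcont.integrable_of_hasCompactSupport (h.compactSupp t)) h1 h2 hx

/-- Grönwall-type estimate: a positive function with log-Lipschitz logarithmic derivative decays at
most double exponentially. -/
lemma exp_neg_le_of_abs_deriv_le {f f' : ℝ → ℝ} {D : ℝ} (hD : 0 ≤ D)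
    (hf : ∀ t, 0 ≤ t → HasDerivAt f (f' t) t) (hpos : ∀ t, 0 ≤ t → 0 < f t)
    (hbd : ∀ t, 0 ≤ t → |f' t| ≤ D / 2 * (f t * (1 + |Real.log (f t)|))) {t : ℝ} (ht : 0 ≤ t) :
    Real.exp (-(Real.sqrt (1 + Real.log (f 0) ^ 2) * Real.exp (D * t))) ≤ f t := by
  set g : ℝ → ℝ := fun t => Real.sqrt (1 + Real.log (f t) ^ 2) with hg
  have hg1 : ∀ t, 1 ≤ g t := fun t => Real.one_le_sqrt.2 (by nlinarith [sq_nonneg (Real.log (f t))])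
  have hgl : ∀ t, |Real.log (f t)| ≤ g t := fun t =>
    Real.le_sqrt_of_sq_le (by rw [sq_abs]; linarith)
  have hgd : ∀ t, 0 ≤ t →
      HasDerivAt g (2 * Real.log (f t) * (f' t / f t) / (2 * g t)) t := by
    intro t ht
    have h1 := (hf t ht).log (hpos t ht).ne'
    have h2 : HasDerivAt (fun y => 1 + Real.log (f y) ^ 2)
        (2 * Real.log (f t) * (f' t / f t)) t :=
      ((h1.pow 2).const_add 1).congr_deriv (by simp)
    exact h2.sqrt (by positivity)
  have hle : ∀ t, 0 ≤ t → 2 * Real.log (f t) * (f' t / f t) / (2 * g t) ≤ D * g t := by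
    intro t ht
    have hgp : 0 < g t := one_pos.trans_le (hg1 t)
    have h1 : |f' t / f t| ≤ D / 2 * (1 + |Real.log (f t)|) := by
      rw [abs_div, abs_of_pos (hpos t ht), div_le_iff₀ (hpos t ht)]
      have := hbd t ht
      linarith
    have h2 : |f' t / f t| ≤ D * g t := by
      refine h1.trans ?_
      nlinarith [hg1 t, hgl t]
    rw [div_le_iff₀ (by positivity)]
    have h3 : Real.log (f t) * (f' t / f t) ≤ g t * (D * g t) := by
      refine (le_abs_self _).trans ?_
      rw [abs_mul]
      exact mul_le_mul (hgl t) h2 (abs_nonneg _) hgp.le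
    linarith
  have hanti : AntitoneOn (fun t => g t * Real.exp (-D * t)) (Ici 0) := by
    have hd : ∀ t, 0 ≤ t → HasDerivAt (fun t => g t * Real.exp (-D * t))
        (2 * Real.log (f t) * (f' t / f t) / (2 * g t) * Real.exp (-D * t)
          + g t * (Real.exp (-D * t) * (-D * 1))) t := fun t ht =>
      (hgd t ht).mul ((hasDerivAt_id t).const_mul (-D)).exp
    refine antitoneOn_of_deriv_nonpos (convex_Ici 0)
      (fun t ht => (hd t ht).continuousAt.continuousWithinAt)
      (fun t ht => (hd t (interior_subset ht)).differentiableAt.differentiableWithinAt)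
      fun t ht => ?_
    have ht0 : 0 ≤ t := interior_subset ht
    rw [(hd t ht0).deriv]
    have := mul_le_mul_of_nonneg_right (hle t ht0) (Real.exp_pos (-D * t)).le
    linarith
  have h1 : g t * Real.exp (-D * t) ≤ g 0 := by
    simpa using hanti (mem_Ici.2 le_rfl : (0 : ℝ) ∈ Ici 0) ht ht
  have h2 : g t ≤ g 0 * Real.exp (D * t) := by
    have := mul_le_mul_of_nonneg_right h1 (Real.exp_pos (D * t)).le
    rwa [mul_assoc, ← Real.exp_add, neg_mul, neg_add_cancel, Real.exp_zero, mul_one] at this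
  rw [← Real.le_log_iff_exp_le (hpos t ht)]
  have h3 := neg_abs_le (Real.log (f t))
  have h4 := hgl t
  change -(g 0 * Real.exp (D * t)) ≤ _
  linarith


end HelperLemmas

/-- Theorem 2.5: for a smooth Euler solution on `ℍ` (no sign condition on the
vorticity), every fluid trajectory `X` with `X₂(0) > 0` satisfies
`X₂(t) ≥ exp(-√(1 + log²(X₂(0))) e^{Dt})`, where `D > 0` depends only on the
`L¹` and `L^∞` norms of the initial vorticity. -/
theorem stmt_9 (A B : ℝ) :
    ∃ D : ℝ, 0 < D ∧
      ∀ (ω : ℝ → ℝ × ℝ → ℝ) (u : ℝ → ℝ × ℝ → ℝ × ℝ),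
        IsEulerSol ω u →
        (∫ y in Hplane, |ω 0 y|) ≤ A →
        (∀ y, |ω 0 y| ≤ B) →
        ∀ X : ℝ → ℝ × ℝ,
          (∀ t, 0 ≤ t → HasDerivAt X (u t (X t)) t) →
          (∀ t, 0 ≤ t → X t ∈ Hplane) →
          0 < (X 0).2 →
          ∀ t, 0 ≤ t →
            (X t).2 ≥
              Real.exp (-(Real.sqrt (1 + Real.log ((X 0).2) ^ 2) * Real.exp (D * t))) := by
  refine ⟨2 * (|A| + 8 * |B|) + 1, by positivity, ?_⟩
  intro ω u h hA hB X hX hXH _ t ht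
  refine exp_neg_le_of_abs_deriv_le (f := fun t => (X t).2) (f' := fun t => (u t (X t)).2)
    (by positivity) (fun s hs => ?_) (fun s hs => hXH s hs) (fun s hs => ?_) ht
  · exact (ContinuousLinearMap.snd ℝ ℝ ℝ).hasFDerivAt.comp_hasDerivAt s (hX s hs)
  · have hpos : 0 < (X s).2 := hXH s hs
    refine (h.abs_velocity_snd_le hA hB hs (hXH s hs)).trans ?_
    have hl := abs_nonneg (Real.log (X s).2)
    have h1 : A ≤ |A| * (1 + |Real.log (X s).2|) := by
      nlinarith [le_abs_self A, mul_nonneg (abs_nonneg A) hl]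
    have h2 : 8 * B * (1 + |Real.log (X s).2|) ≤ 8 * |B| * (1 + |Real.log (X s).2|) := by
      gcongr
      exact le_abs_self B
    have h3 : A + 8 * B * (1 + |Real.log (X s).2|)
        ≤ (2 * (|A| + 8 * |B|) + 1) / 2 * (1 + |Real.log (X s).2|) := by linarith
    have h4 := mul_le_mul_of_nonneg_left h3 hpos.le
    linarith
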